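/- Let G be a uniformly random DAG on n labeled vertices. For all i, ℓ ∈ ℕ with ℓ ≥ 5 and all sufficiently large n, the probability that the i-th layer of the tower decomposition of G has size at least ℓ satisfies Pr[h_i(G) ≥ ℓ] ≤ 2^{-ℓ²/4 + 2}. -/

import Mathlib

namespace CausalMEC

/-- A directed graph on `Fin n`, given by a Boolean edge function (`d a b = true` means `a → b`). -/
abbrev Dir (n : ℕ) := Fin n → Fin n → Bool

/-- Directed reachability (zero or more steps). -/
def Reach {n : ℕ} (d : Dir n) : Fin n → Fin n → Prop :=
  Relation.ReflTransGen fun a b => d a b = true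

/-- No directed cycles (including no self-loops). -/
def Acyclic {n : ℕ} (d : Dir n) : Prop :=
  ∀ v, ¬ Relation.TransGen (fun a b => d a b = true) v v

/-- A directed acyclic graph. -/
def IsDAG {n : ℕ} (d : Dir n) : Prop :=
  (∀ v, d v v = false) ∧ Acyclic d

/-- A directed (possibly cyclic) graph with edges between distinct vertices. -/
def IsDCG {n : ℕ} (d : Dir n) : Prop :=
  ∀ v, d v v = false

/-- The number of directed edges. -/
def edgeCount {n : ℕ} (d : Dir n) : ℕ :=
  (Finset.univ.filter fun q : Fin n × Fin n => d q.1 q.2 = true).card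

/-- The parent set of a vertex. -/
def parents {n : ℕ} (d : Dir n) (v : Fin n) : Finset (Fin n) :=
  Finset.univ.filter fun u => d u v = true

/-! ### Paths, d-connection and Markov equivalence in mixed graphs
A mixed graph is given by a directed part `d` and a bidirected part `b`. -/

/-- The kind of a step on a path: a directed edge traversed forwards, a directed edge
traversed backwards, or a bidirected edge. -/
inductive EdgeKind : Type
  | fwd | bwd | bidir
deriving DecidableEq

/-- Does the step point into its second endpoint? -/
def EdgeKind.intoSnd : EdgeKind → Bool
  | .fwd => true
  | .bwd => false
  | .bidir => true

/-- Does the step point into its first endpoint? -/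
def EdgeKind.intoFst : EdgeKind → Bool
  | .fwd => false
  | .bwd => true
  | .bidir => true

/-- A (possibly self-intersecting) path from `u` to `v` in the mixed graph `(d, b)`. -/
structure MPath {n : ℕ} (d b : Dir n) (u v : Fin n) where
  len : ℕ
  vert : Fin (len + 1) → Fin n
  kind : Fin len → EdgeKind
  first_eq : vert 0 = u
  last_eq : vert (Fin.last len) = v
  valid : ∀ i : Fin len,
    (kind i = .fwd → d (vert i.castSucc) (vert i.succ) = true) ∧
    (kind i = .bwd → d (vert i.succ) (vert i.castSucc) = true) ∧
    (kind i = .bidir → b (vert i.castSucc) (vert i.succ) = true)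

/-- Whether the internal vertex at position `i` of a path is a collider. -/
def MPath.colliderAt {n : ℕ} {d b : Dir n} {u v : Fin n} (π : MPath d b u v)
    (i : ℕ) (h1 : 0 < i) (h2 : i < π.len) : Bool :=
  (π.kind ⟨i - 1, by omega⟩).intoSnd && (π.kind ⟨i, h2⟩).intoFst

/-- A path is active given a conditioning set `Z` if every non-collider on it avoids `Z`
and every collider on it is in `Z` or has a descendant in `Z`. -/
def MPath.Active {n : ℕ} {d b : Dir n} {u v : Fin n} (π : MPath d b u v)
    (Z : Finset (Fin n)) : Prop :=
  ∀ (i : ℕ) (h1 : 0 < i) (h2 : i < π.len),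
    (π.colliderAt i h1 h2 = true →
      ∃ x ∈ Z, Reach d (π.vert ⟨i, by omega⟩) x) ∧
    (π.colliderAt i h1 h2 = false →
      π.vert ⟨i, by omega⟩ ∉ Z)

/-- d-connection given a conditioning set. -/
def DConn {n : ℕ} (d b : Dir n) (u v : Fin n) (Z : Finset (Fin n)) : Prop :=
  ∃ π : MPath d b u v, π.Active Z

/-- Markov equivalence of two mixed graphs: the same d-connection relations. -/
def MarkovEquiv {n : ℕ} (d b d' b' : Dir n) : Prop :=
  ∀ (u v : Fin n) (Z : Finset (Fin n)), u ≠ v → u ∉ Z → v ∉ Z →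
    (DConn d b u v Z ↔ DConn d' b' u v Z)

/-- The empty bidirected part: a purely directed graph. -/
def noBi (n : ℕ) : Dir n := fun _ _ => false

/-- Markov equivalence for purely directed graphs. -/
def MarkovEquivD {n : ℕ} (d d' : Dir n) : Prop :=
  MarkovEquiv d (noBi n) d' (noBi n)

/-- The Markov equivalence class of a DAG (within DAGs). -/
def MECdag {n : ℕ} (d : Dir n) : Set (Dir n) :=
  {d' | IsDAG d' ∧ MarkovEquivD d d'}

/-- An acyclic directed mixed graph. -/
def IsADMG {n : ℕ} (d b : Dir n) : Prop :=
  IsDAG d ∧ (∀ v w, b v w = b w v) ∧ (∀ v, b v v = false)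

/-- The Markov equivalence class of an ADMG (within ADMGs). -/
def MECadmg {n : ℕ} (d b : Dir n) : Set (Dir n × Dir n) :=
  {G | IsADMG G.1 G.2 ∧ MarkovEquiv d b G.1 G.2}

/-- The Markov equivalence class of a DCG (within DCGs). -/
def MECdcg {n : ℕ} (d : Dir n) : Set (Dir n) :=
  {d' | IsDCG d' ∧ MarkovEquivD d d'}

/-! ### The distribution `D(n,p)` and uniform ADMGs/DCGs -/

/-- The (unnormalized) weight of a DAG under `D(n,p)`. -/
noncomputable def dagWeight {n : ℕ} (p : ℝ) (d : Dir n) : ℝ :=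
  (p / (1 - p)) ^ edgeCount d

open scoped Classical in
/-- Probability of the event `A` under `D(n,p)`. -/
noncomputable def prD (n : ℕ) (p : ℝ) (A : Dir n → Prop) : ℝ :=
  (∑ d : Dir n, if IsDAG d ∧ A d then dagWeight p d else 0) /
    (∑ d : Dir n, if IsDAG d then dagWeight p d else 0)

open scoped Classical in
/-- Expectation of `f` under `D(n,p)`. -/
noncomputable def expD (n : ℕ) (p : ℝ) (f : Dir n → ℝ) : ℝ :=
  (∑ d : Dir n, if IsDAG d then f d * dagWeight p d else 0) /
    (∑ d : Dir n, if IsDAG d then dagWeight p d else 0)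

/-- Conditional probability of `A` given `B` under `D(n,p)`. -/
noncomputable def condPrD (n : ℕ) (p : ℝ) (A B : Dir n → Prop) : ℝ :=
  prD n p (fun d => A d ∧ B d) / prD n p B

open scoped Classical in
/-- Expectation of `f` under the uniform distribution on ADMGs on `n` vertices. -/
noncomputable def expADMG (n : ℕ) (f : Dir n × Dir n → ℝ) : ℝ :=
  (∑ G : Dir n × Dir n, if IsADMG G.1 G.2 then f G else 0) /
    (∑ G : Dir n × Dir n, if IsADMG G.1 G.2 then (1 : ℝ) else 0)

open scoped Classical in
/-- Expectation of `f` under the uniform distribution on DCGs on `n` vertices. -/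
noncomputable def expDCG (n : ℕ) (f : Dir n → ℝ) : ℝ :=
  (∑ d : Dir n, if IsDCG d then f d else 0) /
    (∑ d : Dir n, if IsDCG d then (1 : ℝ) else 0)

open scoped Classical in
/-- Probability of the event `A` under the uniform distribution on DCGs on `n` vertices. -/
noncomputable def prDCG (n : ℕ) (A : Dir n → Prop) : ℝ :=
  (∑ d : Dir n, if IsDCG d ∧ A d then (1 : ℝ) else 0) /
    (∑ d : Dir n, if IsDCG d then (1 : ℝ) else 0)

/-! ### Tower decomposition -/

/-- The sources of `d` within a vertex set `S` (no parents inside `S`). -/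
def sourcesIn {n : ℕ} (d : Dir n) (S : Finset (Fin n)) : Finset (Fin n) :=
  S.filter fun v => ∀ u ∈ S, d u v = false

/-- The vertices remaining after peeling off `k` layers of sources. -/
def remaining {n : ℕ} (d : Dir n) : ℕ → Finset (Fin n)
  | 0 => Finset.univ
  | k + 1 => remaining d k \ sourcesIn d (remaining d k)

/-- The `i`-th layer (1-based) of the tower decomposition of `d`. -/
def towerLayer {n : ℕ} (d : Dir n) (i : ℕ) : Finset (Fin n) :=
  sourcesIn d (remaining d (i - 1))

/-- The 1-based index of the layer containing `v`. -/
def layerIdx {n : ℕ} (d : Dir n) (v : Fin n) : ℕ :=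
  ((Finset.range n).filter fun j => v ∈ remaining d j).card

/-- The tower of a DAG: only the edges between adjacent layers are kept. -/
def tower {n : ℕ} (d : Dir n) : Dir n :=
  fun a c => d a c && decide (layerIdx d c = layerIdx d a + 1)

/-- `h` is the tower vector of `d` (layer sizes, 1-based, and no further layers). -/
def hasTowerVector {n : ℕ} (d : Dir n) (h : List ℕ) : Prop :=
  (∀ i : Fin h.length, (towerLayer d (i.val + 1)).card = h.get i) ∧
    towerLayer d (h.length + 1) = ∅

/-- `H` is the tower decomposition of `d`. -/
def hasTowerDecomp {n : ℕ} (d : Dir n) (H : List (Finset (Fin n))) : Prop :=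
  (∀ i : Fin H.length, towerLayer d (i.val + 1) = H.get i) ∧
    towerLayer d (H.length + 1) = ∅

/-- The weight `w(h)` of a tower vector `h = (h_1, …, h_s)`. -/
noncomputable def towerWeight (p : ℝ) (h : List ℕ) : ℝ :=
  (Nat.multinomial Finset.univ (fun i : Fin h.length => h.get i) : ℝ) *
    ∏ k ∈ Finset.Icc 2 h.length,
      (1 - (1 - p) ^ h.getD (k - 2) 0) ^ h.getD (k - 1) 0 /
        (1 - p) ^ (h.getD (k - 1) 0 * ∑ i ∈ Finset.range (k - 1), h.getD i 0)

/-! ### Edge reversal and deletion -/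

/-- Reverse the edge `v → w`. -/
def reverseEdge {n : ℕ} (d : Dir n) (v w : Fin n) : Dir n :=
  fun a c => if a = v ∧ c = w then false else if a = w ∧ c = v then true else d a c

/-- Delete the edge `v → w`. -/
def deleteEdge {n : ℕ} (d : Dir n) (v w : Fin n) : Dir n :=
  fun a c => if a = v ∧ c = w then false else d a c

/-- The edge `v → w` of a DAG is reversible: reversing it yields a Markov-equivalent DAG. -/
def Reversible {n : ℕ} (d : Dir n) (v w : Fin n) : Prop :=
  d v w = true ∧ IsDAG (reverseEdge d v w) ∧ MarkovEquivD d (reverseEdge d v w)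

/-- `d` has a matching of reversible layer-2-edges of size at least `m`. -/
def hasRevL2Matching {n : ℕ} (d : Dir n) (m : ℝ) : Prop :=
  ∃ S : Finset (Fin n × Fin n),
    (∀ e ∈ S, Reversible d e.1 e.2 ∧ e.2 ∈ towerLayer d 2) ∧
    (∀ e ∈ S, ∀ e' ∈ S, e ≠ e' →
      e.1 ≠ e'.1 ∧ e.1 ≠ e'.2 ∧ e.2 ≠ e'.1 ∧ e.2 ≠ e'.2) ∧
    m ≤ (S.card : ℝ)

/-! ### Cycles and the `Reverse` construction -/

/-- Cyclic successor in `Fin k`. -/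
def cycSucc {k : ℕ} (i : Fin k) : Fin k :=
  ⟨(i.val + 1) % k, Nat.mod_lt _ i.pos⟩

/-- The reversed parametrization of a cycle. -/
def cycRev {n k : ℕ} (c : Fin k → Fin n) : Fin k → Fin n :=
  fun i => c ⟨(k - i.val) % k, Nat.mod_lt _ i.pos⟩

/-- `c` lists the (distinct) vertices of a directed cycle of `d`, in order. -/
def IsCycle {n k : ℕ} (d : Dir n) (c : Fin k → Fin n) : Prop :=
  Function.Injective c ∧ ∀ i, d (c i) (c (cycSucc i)) = true

/-- The `Reverse(G, C)` construction: reverse the cycle `c` and redirect every edge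
`w → v_i` with `w ∈ Pa(v_i) \ {v_{i-1}}` to `w → v_{i-1}`. -/
def reverseCycle {n k : ℕ} (d : Dir n) (c : Fin k → Fin n) : Dir n :=
  fun a e =>
    decide ((∃ j : Fin k, e = c j ∧
        (a = c (cycSucc j) ∨ (d a (c (cycSucc j)) = true ∧ a ≠ c j))) ∨
      ((∀ j : Fin k, e ≠ c j) ∧ d a e = true))

/-- A vertex triple induces exactly a directed 3-cycle. -/
def induces3Cycle {n : ℕ} (d : Dir n) (W : Finset (Fin n)) : Prop :=
  ∃ a b c : Fin n, W = {a, b, c} ∧ a ≠ b ∧ a ≠ c ∧ b ≠ c ∧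
    d a b = true ∧ d b c = true ∧ d c a = true ∧
    d b a = false ∧ d c b = false ∧ d a c = false

open Finset

theorem sum_le_sum_of_fibers {α β : Type*} [DecidableEq β] (X : Finset α) (φ : α → β)
    (f g : α → ℕ)
    (h : ∀ x₀ ∈ X, ∑ x ∈ X with φ x = φ x₀, f x ≤ ∑ x ∈ X with φ x = φ x₀, g x) :
    ∑ x ∈ X, f x ≤ ∑ x ∈ X, g x := by
  rw [← Finset.sum_fiberwise_of_maps_to (t := X.image φ) (g := φ)
      (fun x hx => Finset.mem_image_of_mem φ hx) f,
    ← Finset.sum_fiberwise_of_maps_to (t := X.image φ) (g := φ)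
      (fun x hx => Finset.mem_image_of_mem φ hx) g]
  refine Finset.sum_le_sum fun y hy => ?_
  obtain ⟨x₀, hx₀, rfl⟩ := Finset.mem_image.1 hy
  exact h x₀ hx₀

theorem not_transGen_self_of_closed {α : Type*} {r : α → α → Prop} (R : α → Prop)
    (hcl : ∀ a b, R a → r a b → R b)
    (hin : ∀ v, ¬ Relation.TransGen (fun a b => R a ∧ R b ∧ r a b) v v)
    (hout : ∀ v, ¬ Relation.TransGen (fun a b => ¬ R a ∧ ¬ R b ∧ r a b) v v) (v : α) :
    ¬ Relation.TransGen r v v := by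
  intro hv
  by_cases hR : R v
  · have key : ∀ b, Relation.TransGen r v b →
        Relation.TransGen (fun a b => R a ∧ R b ∧ r a b) v b ∧ R b := by
      intro b hb
      induction hb with
      | single h => exact ⟨.single ⟨hR, hcl _ _ hR h, h⟩, hcl _ _ hR h⟩
      | tail _ h ih => exact ⟨ih.1.tail ⟨ih.2, hcl _ _ ih.2 h, h⟩, hcl _ _ ih.2 h⟩
    exact hin v (key v hv).1
  · have key : ∀ a, Relation.TransGen r a v →
        Relation.TransGen (fun a b => ¬ R a ∧ ¬ R b ∧ r a b) a v ∧ ¬ R a := by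
      intro a ha
      induction ha using Relation.TransGen.head_induction_on with
      | single h => exact ⟨.single ⟨fun h' => hR (hcl _ _ h' h), hR, h⟩, fun h' => hR (hcl _ _ h' h)⟩
      | head h _ ih =>
        exact ⟨ih.1.head ⟨fun h' => ih.2 (hcl _ _ h' h), ih.2, h⟩, fun h' => ih.2 (hcl _ _ h' h)⟩
    exact hout v (key v hv).1

/-- The subgraph of `d` induced on `S` has no directed cycle. -/
def AcyclicOn {n : ℕ} (d : Dir n) (S : Finset (Fin n)) : Prop :=
  ∀ v, ¬ Relation.TransGen (fun a b => a ∈ S ∧ b ∈ S ∧ d a b = true) v v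

theorem AcyclicOn.mono {n : ℕ} {d : Dir n} {S T : Finset (Fin n)} (h : AcyclicOn d S)
    (hT : T ⊆ S) : AcyclicOn d T :=
  fun v hv => h v (Relation.TransGen.mono (fun _ _ hab => ⟨hT hab.1, hT hab.2.1, hab.2.2⟩) _ _ hv)

theorem AcyclicOn.congr {n : ℕ} {d d' : Dir n} {S : Finset (Fin n)} (h : AcyclicOn d S)
    (hd : ∀ a ∈ S, ∀ b ∈ S, d a b = d' a b) : AcyclicOn d' S :=
  fun v hv => h v (Relation.TransGen.mono (fun a b hab =>
    ⟨hab.1, hab.2.1, (hd a hab.1 b hab.2.1).trans hab.2.2⟩) _ _ hv)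

theorem mem_sourcesIn {n : ℕ} {d : Dir n} {S : Finset (Fin n)} {v : Fin n} :
    v ∈ sourcesIn d S ↔ v ∈ S ∧ ∀ u ∈ S, d u v = false := by
  simp [sourcesIn]

theorem acyclicOn_of_erase_source {n : ℕ} {d : Dir n} {S : Finset (Fin n)} {u : Fin n}
    (hu : u ∈ sourcesIn d S) (h : AcyclicOn d (S.erase u)) : AcyclicOn d S := by
  have hu' := (mem_sourcesIn.1 hu).2
  refine not_transGen_self_of_closed (fun a => a ∈ S.erase u) ?_ ?_ ?_
  · rintro a b - ⟨ha, hb, hab⟩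
    refine mem_erase.2 ⟨?_, hb⟩
    rintro rfl
    simp [hu' a ha] at hab
  · exact fun v hv => h v (Relation.TransGen.mono
      (fun a b hab => ⟨hab.1, hab.2.1, hab.2.2.2.2⟩) _ _ hv)
  · intro v hv
    obtain ⟨a, -, ha⟩ := Relation.TransGen.tail'_iff.1 hv
    obtain ⟨-, hv', haS, hvS, hav⟩ := ha
    have : v = u := by
      by_contra hne
      exact hv' (mem_erase.2 ⟨hne, hvS⟩)
    subst this
    simp [hu' a haS] at hav

open scoped Classical in
/-- The digraphs that agree with `e` except on edges inside `S`, are acyclic on `S`, and have all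
their sources within `S` in `M`. -/
noncomputable def dagsOn {n : ℕ} (e : Dir n) (S M : Finset (Fin n)) : Finset (Dir n) :=
  univ.filter fun d => (∀ a b, ¬ (a ∈ S ∧ b ∈ S) → d a b = e a b) ∧ AcyclicOn d S ∧
    sourcesIn d S ⊆ M

theorem mem_dagsOn {n : ℕ} {e d : Dir n} {S M : Finset (Fin n)} :
    d ∈ dagsOn e S M ↔ (∀ a b, ¬ (a ∈ S ∧ b ∈ S) → d a b = e a b) ∧ AcyclicOn d S ∧
      sourcesIn d S ⊆ M := by
  simp [dagsOn]

/-- Delete all edges inside `S`. -/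
def eraseInside {n : ℕ} (S : Finset (Fin n)) (d : Dir n) : Dir n :=
  fun a b => if a ∈ S ∧ b ∈ S then false else d a b

theorem eraseInside_eq_iff {n : ℕ} {S : Finset (Fin n)} {d d' : Dir n} :
    eraseInside S d = eraseInside S d' ↔ ∀ a b, ¬ (a ∈ S ∧ b ∈ S) → d a b = d' a b := by
  constructor
  · intro h a b hab
    have := congrFun (congrFun h a) b
    simpa [eraseInside, hab] using this
  · intro h
    funext a b
    unfold eraseInside
    split_ifs with hab
    · rfl
    · exact h a b hab

theorem dagsOn_source_fiber {n : ℕ} {e d₀ : Dir n} {S M : Finset (Fin n)} {u : Fin n}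
    (hd₀ : d₀ ∈ dagsOn e S M) (hu : u ∈ sourcesIn d₀ S) :
    ((dagsOn e S M).filter fun d => u ∈ sourcesIn d S).filter
        (fun d => eraseInside (S.erase u) d = eraseInside (S.erase u) d₀) =
      dagsOn d₀ (S.erase u) (M ∪ univ.filter fun v => d₀ u v = true) := by
  obtain ⟨h1, h2, h3⟩ := mem_dagsOn.1 hd₀
  obtain ⟨huS, hu'⟩ := mem_sourcesIn.1 hu
  ext d
  simp only [mem_filter, eraseInside_eq_iff, mem_dagsOn]
  constructor
  · rintro ⟨⟨⟨-, g2, g3⟩, g4⟩, g5⟩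
    refine ⟨g5, g2.mono (erase_subset _ _), fun v hv => ?_⟩
    obtain ⟨hvS, hv'⟩ := mem_sourcesIn.1 hv
    by_cases huv : d₀ u v = true
    · simp [huv]
    · refine mem_union_left _ (g3 (mem_sourcesIn.2 ⟨mem_of_mem_erase hvS, fun w hw => ?_⟩))
      by_cases hwu : w = u
      · subst hwu
        rw [g5 w v (by simp)]
        simpa using huv
      · exact hv' w (mem_erase.2 ⟨hwu, hw⟩)
  · rintro ⟨g5, g2, g3⟩
    have g4 : u ∈ sourcesIn d S := mem_sourcesIn.2 ⟨huS, fun w hw => by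
      rw [g5 w u (by simp)]
      exact hu' w hw⟩
    refine ⟨⟨⟨fun a b hab => ?_, acyclicOn_of_erase_source g4 g2, fun v hv => ?_⟩, g4⟩, g5⟩
    · rw [g5 a b fun h => hab ⟨mem_of_mem_erase h.1, mem_of_mem_erase h.2⟩, h1 a b hab]
    · obtain ⟨hvS, hv'⟩ := mem_sourcesIn.1 hv
      by_cases hvu : v = u
      · exact hvu ▸ h3 hu
      · have := g3 (mem_sourcesIn.2 ⟨mem_erase.2 ⟨hvu, hvS⟩, fun w hw =>
          hv' w (mem_of_mem_erase hw)⟩)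
        rcases mem_union.1 this with h | h
        · exact h
        · have h := (mem_filter.1 h).2
          rw [← g5 u v (by simp), hv' u huS] at h
          cases h

theorem sum_source_le {n : ℕ} (e : Dir n) (S M : Finset (Fin n)) (u : Fin n)
    (c c' : ℕ) (g : Dir n → ℕ)
    (h : ∀ e' M', c' * ∑ d ∈ dagsOn e' (S.erase u) M', g d ≤ c * #(dagsOn e' (S.erase u) M')) :
    c' * ∑ d ∈ dagsOn e S M with u ∈ sourcesIn d S, g d ≤
      c * #{d ∈ dagsOn e S M | u ∈ sourcesIn d S} := by
  have := sum_le_sum_of_fibers {d ∈ dagsOn e S M | u ∈ sourcesIn d S}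
    (eraseInside (S.erase u)) (fun d => c' * g d) (fun _ => c) ?_
  · rw [← mul_sum, sum_const, smul_eq_mul, mul_comm _ c] at this
    exact this
  · intro d₀ hd₀
    obtain ⟨hd₀, hu⟩ := mem_filter.1 hd₀
    rw [dagsOn_source_fiber hd₀ hu, ← mul_sum, sum_const, smul_eq_mul, mul_comm _ c]
    exact h _ _

/-- Add the edges from `u` to the vertices of `W`. -/
def addOut {n : ℕ} (u : Fin n) (W : Finset (Fin n)) (d : Dir n) : Dir n :=
  fun a b => if a = u ∧ b ∈ W then true else d a b

theorem card_sources_superset_le {n : ℕ} (e : Dir n) (S M : Finset (Fin n)) (u : Fin n)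
    (T : Finset (Fin n)) (hT : T ⊆ S.erase u) :
    2 ^ #T * #{d ∈ dagsOn e S M | u ∈ sourcesIn d S ∧ T ⊆ sourcesIn d S} ≤
      #{d ∈ dagsOn e S M | u ∈ sourcesIn d S ∧ T ⊆ sourcesIn d (S.erase u)} := by
  rw [← card_powerset, ← card_product]
  refine card_le_card_of_injOn (fun p => addOut u p.1 p.2) ?_ ?_
  · rintro ⟨W, d⟩ hp
    simp only [coe_product, Set.mem_prod, mem_coe, mem_powerset, mem_filter, mem_dagsOn] at hp
    obtain ⟨hW, ⟨g1, g2, g3⟩, g4, g5⟩ := hp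
    obtain ⟨huS, hu⟩ := mem_sourcesIn.1 g4
    have hWS : W ⊆ S.erase u := hW.trans hT
    have off : ∀ a b, a ≠ u → addOut u W d a b = d a b := by
      intro a b hab
      simp [addOut, hab]
    have hle : ∀ a b, d a b = true → addOut u W d a b = true := by
      intro a b hab
      simp [addOut, hab]
    have hu4 : u ∈ sourcesIn (addOut u W d) S := by
      refine mem_sourcesIn.2 ⟨huS, fun w hw => ?_⟩
      have : u ∉ W := fun h => by simpa using hWS h
      simp [addOut, this, hu w hw]
    simp only [coe_filter, Set.mem_ofPred_eq, mem_dagsOn]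
    refine ⟨⟨fun a b hab => ?_, ?_, fun v hv => ?_⟩, hu4, fun v hv => ?_⟩
    · rw [← g1 a b hab]
      have : ¬ (a = u ∧ b ∈ W) := by
        rintro ⟨rfl, hb⟩
        exact hab ⟨huS, mem_of_mem_erase (hWS hb)⟩
      simp [addOut, this]
    · exact acyclicOn_of_erase_source hu4 ((g2.mono (erase_subset u S)).congr
        fun a ha b _ => (off a b (ne_of_mem_erase ha)).symm)
    · obtain ⟨hvS, hv⟩ := mem_sourcesIn.1 hv
      refine g3 (mem_sourcesIn.2 ⟨hvS, fun w hw => ?_⟩)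
      by_contra hne
      have := hle w v (by simpa using hne)
      simp [hv w hw] at this
    · refine mem_sourcesIn.2 ⟨hT hv, fun w hw => ?_⟩
      rw [off w v (ne_of_mem_erase hw)]
      exact (mem_sourcesIn.1 (g5 hv)).2 w (mem_of_mem_erase hw)
  · rintro ⟨W, d⟩ hp ⟨W', d'⟩ hp' heq
    simp only [coe_product, Set.mem_prod, mem_coe, mem_powerset, mem_filter] at hp hp'
    obtain ⟨hW, -, g4, g5⟩ := hp
    obtain ⟨hW', -, -, g5'⟩ := hp'
    have huS := (mem_sourcesIn.1 g4).1
    have e1 : ∀ b ∈ T, d u b = false := fun b hb => (mem_sourcesIn.1 (g5 hb)).2 u huS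
    have e2 : ∀ b ∈ T, d' u b = false := fun b hb => (mem_sourcesIn.1 (g5' hb)).2 u huS
    have hEq : ∀ a b, addOut u W d a b = addOut u W' d' a b :=
      fun a b => congrFun (congrFun heq a) b
    have hWW : W = W' := by
      ext b
      constructor
      · intro hb
        by_contra hb'
        have := hEq u b
        simp [addOut, hb, hb', e2 b (hW hb)] at this
      · intro hb
        by_contra hb'
        have := hEq u b
        simp [addOut, hb, hb', e1 b (hW' hb)] at this
    subst hWW
    refine Prod.ext rfl ?_
    funext a b
    by_cases hab : a = u ∧ b ∈ W
    · obtain ⟨rfl, hb⟩ := hab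
      simp [e1 b (hW hb), e2 b (hW hb)]
    · simpa [addOut, hab] using hEq a b

theorem sum_choose_card_eq {ι α : Type*} [DecidableEq α] (X : Finset ι) (A : ι → Finset α)
    (B : Finset α) (k : ℕ) (hA : ∀ x ∈ X, A x ⊆ B) :
    ∑ x ∈ X, (#(A x)).choose k = ∑ T ∈ B.powersetCard k, #{x ∈ X | T ⊆ A x} := by
  simp_rw [card_filter]
  rw [sum_comm]
  refine sum_congr rfl fun x hx => ?_
  rw [← card_filter, ← card_powersetCard]
  congr 1
  ext T
  simp only [mem_powersetCard, mem_filter]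
  exact ⟨fun h => ⟨⟨h.1.trans (hA x hx), h.2⟩, h.1⟩, fun h => ⟨h.2, h.1.2⟩⟩

theorem sum_choose_erase_source_le {n : ℕ} (e : Dir n) (S M : Finset (Fin n)) (u : Fin n)
    (k : ℕ) :
    2 ^ k * ∑ d ∈ dagsOn e S M with u ∈ sourcesIn d S, (#((sourcesIn d S).erase u)).choose k ≤
      ∑ d ∈ dagsOn e S M with u ∈ sourcesIn d S, (#(sourcesIn d (S.erase u))).choose k := by
  rw [sum_choose_card_eq _ _ (S.erase u) k
      fun d _ => erase_subset_erase u fun _ hv => (mem_sourcesIn.1 hv).1,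
    sum_choose_card_eq _ _ (S.erase u) k fun d _ _ hv => (mem_sourcesIn.1 hv).1, mul_sum]
  refine sum_le_sum fun T hT => ?_
  obtain ⟨hTS, hTk⟩ := mem_powersetCard.1 hT
  have huT : u ∉ T := fun h => by simpa using hTS h
  have := card_sources_superset_le e S M u T hTS
  rw [hTk] at this
  rw [filter_filter, filter_filter]
  simpa only [subset_erase, huT, not_false_eq_true, and_true] using this

theorem sum_card_mul_sources {n : ℕ} (X : Finset (Dir n)) (S : Finset (Fin n))
    (f : Dir n → ℕ) :
    ∑ d ∈ X, #(sourcesIn d S) * f d =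
      ∑ u ∈ S, ∑ d ∈ X with u ∈ sourcesIn d S, f d := by
  simp_rw [sum_filter]
  rw [sum_comm]
  refine sum_congr rfl fun d _ => ?_
  rw [← sum_filter, sum_const, smul_eq_mul]
  congr 2
  ext v
  simp only [mem_filter]
  exact ⟨fun h => ⟨(mem_sourcesIn.1 h).1, h⟩, fun h => h.2⟩

theorem sum_choose_succ_sources_le {n : ℕ} (e : Dir n) (S M : Finset (Fin n)) (k : ℕ) :
    (k + 1) * 2 ^ k * ∑ d ∈ dagsOn e S M, (#(sourcesIn d S)).choose (k + 1) ≤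
      ∑ u ∈ S, ∑ d ∈ dagsOn e S M with u ∈ sourcesIn d S,
        (#(sourcesIn d (S.erase u))).choose k := by
  have h1 : (k + 1) * ∑ d ∈ dagsOn e S M, (#(sourcesIn d S)).choose (k + 1) =
      ∑ u ∈ S, ∑ d ∈ dagsOn e S M with u ∈ sourcesIn d S,
        (#((sourcesIn d S).erase u)).choose k := by
    calc _ = ∑ d ∈ dagsOn e S M, #(sourcesIn d S) * (#(sourcesIn d S) - 1).choose k := by
          rw [mul_sum]
          refine sum_congr rfl fun d _ => ?_
          rcases Nat.eq_zero_or_pos #(sourcesIn d S) with h | h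
          · simp [h]
          · obtain ⟨m, hm⟩ := Nat.exists_eq_add_of_lt h
            rw [hm]
            have := Nat.add_one_mul_choose_eq m k
            simp only [zero_add, Nat.add_sub_cancel]
            rw [this, mul_comm]
      _ = _ := by
          rw [sum_card_mul_sources]
          refine sum_congr rfl fun u _ => sum_congr rfl fun d hd => ?_
          rw [card_erase_of_mem (mem_filter.1 hd).2]
  rw [mul_comm (k + 1), mul_assoc, h1, mul_sum]
  exact sum_le_sum fun u _ => sum_choose_erase_source_le e S M u k

theorem sum_card_sources {n : ℕ} (X : Finset (Dir n)) (S : Finset (Fin n)) :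
    ∑ d ∈ X, #(sourcesIn d S) = ∑ u ∈ S, #{d ∈ X | u ∈ sourcesIn d S} := by
  simpa using sum_card_mul_sources X S fun _ => 1

theorem le_one_add_choose_two (h : ℕ) : h ≤ 1 + h.choose 2 := by
  induction h with
  | zero => simp
  | succ m ih =>
    rw [Nat.choose_succ_succ' m 1, Nat.choose_one_right]
    rcases Nat.eq_zero_or_pos m with rfl | hm
    · simp
    · omega

theorem sum_card_sources_le {n : ℕ} (S : Finset (Fin n)) :
    ∀ e M, ∑ d ∈ dagsOn e S M, #(sourcesIn d S) ≤ 2 * #(dagsOn e S M) := by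
  induction S using Finset.strongInduction with
  | H S ih =>
    intro e M
    have h1 : ∑ d ∈ dagsOn e S M, #(sourcesIn d S) ≤
        #(dagsOn e S M) + ∑ d ∈ dagsOn e S M, (#(sourcesIn d S)).choose 2 := by
      rw [card_eq_sum_ones, ← sum_add_distrib]
      exact sum_le_sum fun d _ => le_one_add_choose_two _
    have h2 := sum_choose_succ_sources_le e S M 1
    have h3 : ∑ u ∈ S, ∑ d ∈ dagsOn e S M with u ∈ sourcesIn d S,
        (#(sourcesIn d (S.erase u))).choose 1 ≤
          2 * ∑ d ∈ dagsOn e S M, #(sourcesIn d S) := by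
      rw [sum_card_sources, mul_sum]
      refine sum_le_sum fun u hu => ?_
      have := sum_source_le e S M u 2 1 (fun d => (#(sourcesIn d (S.erase u))).choose 1)
        fun e' M' => by simpa using ih _ (erase_ssubset hu) e' M'
      simpa only [one_mul] using this
    norm_num at h2 h3
    omega

theorem sum_choose_sources_le {n : ℕ} (k : ℕ) : ∀ (S : Finset (Fin n)) (e : Dir n)
    (M : Finset (Fin n)),
    2 ^ k.choose 2 * ∑ d ∈ dagsOn e S M, (#(sourcesIn d S)).choose k ≤
      2 ^ k * #(dagsOn e S M) := by
  induction k with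
  | zero => simp
  | succ k ih =>
    intro S e M
    calc 2 ^ (k + 1).choose 2 * ∑ d ∈ dagsOn e S M, (#(sourcesIn d S)).choose (k + 1)
        = 2 ^ k.choose 2 * (1 * 2 ^ k *
            ∑ d ∈ dagsOn e S M, (#(sourcesIn d S)).choose (k + 1)) := by
          rw [Nat.choose_succ_succ' k 1, Nat.choose_one_right, pow_add]
          ring
      _ ≤ 2 ^ k.choose 2 * ((k + 1) * 2 ^ k *
            ∑ d ∈ dagsOn e S M, (#(sourcesIn d S)).choose (k + 1)) := by
          gcongr
          omega
      _ ≤ 2 ^ k.choose 2 * ∑ u ∈ S, ∑ d ∈ dagsOn e S M with u ∈ sourcesIn d S,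
            (#(sourcesIn d (S.erase u))).choose k := by
          gcongr
          exact sum_choose_succ_sources_le e S M k
      _ ≤ 2 ^ k * ∑ d ∈ dagsOn e S M, #(sourcesIn d S) := by
          rw [sum_card_sources, mul_sum, mul_sum]
          exact sum_le_sum fun u _ => sum_source_le e S M u _ _ _ fun e' M' => ih _ e' M'
      _ ≤ 2 ^ k * (2 * #(dagsOn e S M)) := by
          gcongr
          exact sum_card_sources_le S e M
      _ = _ := by ring

/-! ### Layers -/

theorem remaining_antitone {n : ℕ} (d : Dir n) : Antitone (remaining d) :=
  antitone_nat_of_succ_le fun _ => sdiff_subset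

theorem mem_remaining_succ {n : ℕ} {d : Dir n} {k : ℕ} {v : Fin n} :
    v ∈ remaining d (k + 1) ↔ v ∈ remaining d k ∧ ∃ u ∈ remaining d k, d u v = true := by
  simp only [remaining, mem_sdiff, mem_sourcesIn]
  constructor
  · rintro ⟨h, h'⟩
    refine ⟨h, ?_⟩
    by_contra! hc
    exact h' ⟨h, fun u hu => by simpa using hc u hu⟩
  · rintro ⟨h, u, hu, huv⟩
    exact ⟨h, fun h' => by simp [h'.2 u hu] at huv⟩

theorem remaining_closed {n : ℕ} {d : Dir n} (k : ℕ) {u v : Fin n}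
    (hu : u ∈ remaining d k) (huv : d u v = true) : v ∈ remaining d k := by
  induction k with
  | zero => simp [remaining]
  | succ k ih =>
    have hu' := (mem_remaining_succ.1 hu).1
    exact mem_remaining_succ.2 ⟨ih hu', u, hu', huv⟩

/-- The remaining vertices after `k` layers that may be sources: all of them for `k = 0`, and those
with a parent in layer `k` otherwise. -/
def sourceCandidates {n : ℕ} (d : Dir n) (k : ℕ) : Finset (Fin n) :=
  (remaining d k).filter fun v =>
    k = 0 ∨ ∃ u ∈ remaining d (k - 1) \ remaining d k, d u v = true

theorem sourcesIn_remaining_subset {n : ℕ} (d : Dir n) (k : ℕ) :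
    sourcesIn d (remaining d k) ⊆ sourceCandidates d k := by
  intro v hv
  obtain ⟨hv, hv'⟩ := mem_sourcesIn.1 hv
  refine mem_filter.2 ⟨hv, ?_⟩
  rcases k with _ | k
  · exact Or.inl rfl
  · obtain ⟨-, u, hu, huv⟩ := mem_remaining_succ.1 hv
    exact Or.inr ⟨u, mem_sdiff.2 ⟨hu, fun h => by simp [hv' u h] at huv⟩, huv⟩

theorem remaining_eq_of_mem_dagsOn {n : ℕ} {d d₀ : Dir n} {k : ℕ}
    (hd : d ∈ dagsOn d₀ (remaining d₀ k) (sourceCandidates d₀ k)) :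
    ∀ j ≤ k, remaining d j = remaining d₀ j := by
  obtain ⟨h1, -, h3⟩ := mem_dagsOn.1 hd
  intro j
  induction j with
  | zero => simp [remaining]
  | succ j ih =>
    intro hj
    have ih := ih (by omega)
    ext v
    rw [mem_remaining_succ, mem_remaining_succ, ih]
    refine and_congr_right fun hvj => ?_
    by_cases hv : v ∈ remaining d₀ k
    · refine iff_of_true ?_ (mem_remaining_succ.1 (remaining_antitone d₀ hj hv)).2
      by_cases hs : v ∈ sourcesIn d (remaining d₀ k)
      · rcases (mem_filter.1 (h3 hs)).2 with h | ⟨u, hu, huv⟩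
        · omega
        · obtain ⟨hu, hu'⟩ := mem_sdiff.1 hu
          refine ⟨u, remaining_antitone d₀ (by omega : j ≤ k - 1) hu, ?_⟩
          rw [h1 u v fun h => hu' h.1, huv]
      · have : ∃ u ∈ remaining d₀ k, d u v = true := by
          by_contra! hc
          exact hs (mem_sourcesIn.2 ⟨hv, fun u hu => by simpa using hc u hu⟩)
        obtain ⟨u, hu, huv⟩ := this
        exact ⟨u, remaining_antitone d₀ (by omega : j ≤ k) hu, huv⟩
    · simp only [h1 _ v fun h => hv h.2]

theorem isDAG_iff_acyclic {n : ℕ} {d : Dir n} : IsDAG d ↔ Acyclic d := by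
  refine ⟨fun h => h.2, fun h => ⟨fun v => ?_, h⟩⟩
  by_contra hv
  exact h v (.single (by simpa using hv))

theorem isDAG_of_mem_dagsOn {n : ℕ} {d d₀ : Dir n} {k : ℕ} {M : Finset (Fin n)}
    (hd₀ : IsDAG d₀) (hd : d ∈ dagsOn d₀ (remaining d₀ k) M) : IsDAG d := by
  obtain ⟨h1, h2, -⟩ := mem_dagsOn.1 hd
  refine isDAG_iff_acyclic.2
    (not_transGen_self_of_closed (fun a => a ∈ remaining d₀ k) ?_ h2 ?_)
  · intro a b ha hab
    by_contra hb
    rw [h1 a b fun h => hb h.2] at hab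
    exact hb (remaining_closed k ha hab)
  · intro v hv
    refine hd₀.2 v (Relation.TransGen.mono (fun a b hab => ?_) _ _ hv)
    rw [← h1 a b fun h => hab.1 h.1]
    exact hab.2.2

open scoped Classical in
theorem isDAG_remaining_fiber {n : ℕ} {d₀ : Dir n} (hd₀ : IsDAG d₀) (k : ℕ) :
    ((univ.filter fun d : Dir n => IsDAG d).filter fun d =>
        (remaining d k, eraseInside (remaining d k) d, sourceCandidates d k) =
          (remaining d₀ k, eraseInside (remaining d₀ k) d₀, sourceCandidates d₀ k)) =
      dagsOn d₀ (remaining d₀ k) (sourceCandidates d₀ k) := by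
  ext d
  simp only [mem_filter, mem_univ, true_and, Prod.mk.injEq]
  constructor
  · rintro ⟨hd, hR, hE, hC⟩
    rw [hR] at hE
    refine mem_dagsOn.2 ⟨eraseInside_eq_iff.1 hE,
      fun v hv => hd.2 v (Relation.TransGen.mono (fun _ _ h => h.2.2) _ _ hv), ?_⟩
    rw [← hR, ← hC]
    exact sourcesIn_remaining_subset d k
  · intro hd
    have hrem := remaining_eq_of_mem_dagsOn hd
    have hR := hrem k le_rfl
    have h1 := (mem_dagsOn.1 hd).1
    refine ⟨isDAG_of_mem_dagsOn hd₀ hd, hR, by rw [hR]; exact eraseInside_eq_iff.2 h1, ?_⟩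
    unfold sourceCandidates
    rw [hR, hrem (k - 1) (by omega)]
    refine filter_congr fun v _ => or_congr_right (exists_congr fun u => ?_)
    refine and_congr_right fun hu => ?_
    rw [h1 u v fun h => (mem_sdiff.1 hu).2 h.1]

open scoped Classical in
theorem card_large_layer_le {n : ℕ} (i ℓ : ℕ) :
    2 ^ ℓ.choose 2 * #{d : Dir n | IsDAG d ∧ ℓ ≤ #(towerLayer d i)} ≤
      2 ^ ℓ * #{d : Dir n | IsDAG d} := by
  have h1 : #{d : Dir n | IsDAG d ∧ ℓ ≤ #(towerLayer d i)} ≤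
      ∑ d : Dir n with IsDAG d, (#(towerLayer d i)).choose ℓ := by
    rw [← filter_filter, card_filter]
    refine sum_le_sum fun d _ => ?_
    split_ifs with h
    · exact Nat.choose_pos h
    · exact Nat.zero_le _
  refine (Nat.mul_le_mul_left _ h1).trans ?_
  have := sum_le_sum_of_fibers (univ.filter fun d : Dir n => IsDAG d)
    (fun d => (remaining d (i - 1), eraseInside (remaining d (i - 1)) d,
      sourceCandidates d (i - 1)))
    (fun d => 2 ^ ℓ.choose 2 * (#(towerLayer d i)).choose ℓ) (fun _ => 2 ^ ℓ) ?_
  · rw [← mul_sum, sum_const, smul_eq_mul, mul_comm _ (2 ^ ℓ)] at this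
    exact this
  · intro d₀ hd₀
    rw [isDAG_remaining_fiber (mem_filter.1 hd₀).2, ← mul_sum, sum_const, smul_eq_mul,
      mul_comm _ (2 ^ ℓ)]
    refine le_trans (le_of_eq ?_)
      (sum_choose_sources_le ℓ (remaining d₀ (i - 1)) d₀ (sourceCandidates d₀ (i - 1)))
    congr 1
    refine sum_congr rfl fun d hd => ?_
    rw [towerLayer, remaining_eq_of_mem_dagsOn hd _ le_rfl]

open scoped Classical in
theorem prD_half_eq (n : ℕ) (A : Dir n → Prop) :
    prD n (1 / 2) A = (#{d : Dir n | IsDAG d ∧ A d} : ℝ) / #{d : Dir n | IsDAG d} := by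
  have hw : ∀ d : Dir n, dagWeight (1 / 2) d = 1 := fun d => by norm_num [dagWeight]
  simp only [prD, hw, sum_boole]

theorem isDAG_empty (n : ℕ) : IsDAG (noBi n) := by
  refine isDAG_iff_acyclic.2 fun v hv => ?_
  obtain ⟨a, -, ha⟩ := Relation.TransGen.tail'_iff.1 hv
  simp [noBi] at ha

/-- Lemma 2.5: for a uniformly random DAG on `n` vertices, for all
`i, ℓ ∈ ℕ` with `ℓ ≥ 5` and all sufficiently large `n`,
`Pr[h_i(G) ≥ ℓ] ≤ 2 ^ (-ℓ²/4 + 2)`. -/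
theorem layer_size_tail_bound (i ℓ : ℕ) (hi : 1 ≤ i) (hℓ : 5 ≤ ℓ) :
    ∃ n₀ : ℕ, ∀ n ≥ n₀,
      prD n (1 / 2) (fun d => ℓ ≤ (towerLayer d i).card) ≤
        (2 : ℝ) ^ (-(ℓ : ℝ) ^ 2 / 4 + 2) := by
  classical
  refine ⟨0, fun n _ => ?_⟩
  rw [prD_half_eq]
  have hpos : (0 : ℝ) < #{d : Dir n | IsDAG d} := by
    exact_mod_cast card_pos.2 ⟨noBi n, by simpa using isDAG_empty n⟩
  have hcount : (2 : ℝ) ^ ℓ.choose 2 * #{d : Dir n | IsDAG d ∧ ℓ ≤ #(towerLayer d i)} ≤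
      2 ^ ℓ * #{d : Dir n | IsDAG d} := by
    exact_mod_cast card_large_layer_le (n := n) i ℓ
  have hexp : (2 : ℝ) ^ ℓ ≤ 2 ^ ℓ.choose 2 * (2 : ℝ) ^ (-(ℓ : ℝ) ^ 2 / 4 + 2) := by
    rw [← Real.rpow_natCast, ← Real.rpow_natCast, ← Real.rpow_add two_pos, Nat.cast_choose_two]
    refine Real.rpow_le_rpow_of_exponent_le one_le_two ?_
    have : (5 : ℝ) ≤ ℓ := by exact_mod_cast hℓ
    nlinarith
  rw [div_le_iff₀ hpos]
  refine le_of_mul_le_mul_left ?_ (by positivity : (0 : ℝ) < 2 ^ ℓ.choose 2)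
  calc _ ≤ (2 : ℝ) ^ ℓ * #{d : Dir n | IsDAG d} := by convert hcount
    _ ≤ 2 ^ ℓ.choose 2 * (2 : ℝ) ^ (-(ℓ : ℝ) ^ 2 / 4 + 2) * #{d : Dir n | IsDAG d} := by
        gcongr
    _ = _ := by ring

end CausalMEC
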